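/- Let d ≥ 1, α, β ≥ 0, λ > 0 with α + λ < d and α + β + λ < d, and define the weighted Riesz-type operator I_{α,β,λ}[f](x) = |x|^{−β} ∫_{ℝ^d} f(y) |y|^{−α} |x−y|^{−λ} dy. Set p_− = d/(d−α), p_+ = d/(d−α−λ), κ = (α+β+λ)/d, and for p ∈ (p_−,p_+) let q = q(p) be defined by 1 + 1/q = 1/p + (α+β+λ)/d. For ψ ∈ Ψ(p_−,p_+) define ψ_{α,β,λ}(p) = [(p−p_−)(p_+−p)]^{−κ} ψ(p). Then there exist constants 0 < C_1(d;α,β,λ) ≤ C_2(d;α,β,λ) < ∞ such that the smallest constant V = V_{α,β,λ} with sup_{p∈(p_−,p_+)} |I_{α,β,λ}[f]|_{q(p)} / ψ_{α,β,λ}(p) ≤ V · ||f||G(ψ) for all ψ ∈ Ψ(p_−,p_+) and all f, satisfies C_1(d;α,β,λ) ≤ V ≤ C_2(d;α,β,λ). -/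

import Mathlib

open MeasureTheory Real Set Filter ENNReal

/-- `ψ ∈ Ψ(I)`: continuous, positive, with positive infimum on the exponent set `I`. -/
def PsiClass (I : Set ℝ) (ψ : ℝ → ℝ) : Prop :=
  ContinuousOn ψ I ∧ (∀ p ∈ I, 0 < ψ p) ∧ ∃ ε > 0, ∀ p ∈ I, ε ≤ ψ p

/-- The Bilateral Grand Lebesgue norm of `f : ℝ^d → ℝ` over the exponent set `I`. -/
noncomputable def BGLS (d : ℕ) (I : Set ℝ) (ψ : ℝ → ℝ)
    (f : EuclideanSpace ℝ (Fin d) → ℝ) : ℝ≥0∞ :=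
  ⨆ p ∈ I, eLpNorm f (ENNReal.ofReal p) volume / ENNReal.ofReal (ψ p)

/-- The kernel `|x|^{-β} |y|^{-α} |x - y|^{-λ}` as an extended nonnegative real. -/
noncomputable def rieszKernel {E : Type*} [NormedAddCommGroup E] (α β lam : ℝ) (x y : E) : ℝ≥0∞ :=
  ENNReal.ofReal (‖x‖ ^ (-β)) * ENNReal.ofReal (‖y‖ ^ (-α)) * ENNReal.ofReal (‖x - y‖ ^ (-lam))

lemma rieszKernel_swap {E : Type*} [NormedAddCommGroup E] (α β lam : ℝ) (x y : E) :
    rieszKernel α β lam x y = rieszKernel β α lam y x := by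
  rw [rieszKernel, rieszKernel, norm_sub_rev]; ring

lemma setLIntegral_norm_sub_rpow_le {E : Type*} [NormedAddCommGroup E] [MeasurableSpace E]
    [BorelSpace E] (μ : Measure E) [μ.IsAddHaarMeasure] {γ e : ℝ} {c : ℝ≥0∞}
    (h : ∀ s : Set E, ∫⁻ x in s, ENNReal.ofReal (‖x‖ ^ (-γ)) ∂μ ≤ c * μ s ^ e) (s : Set E)
    (z : E) : ∫⁻ x in s, ENNReal.ofReal (‖x - z‖ ^ (-γ)) ∂μ ≤ c * μ s ^ e := by
  have hmp : MeasurePreserving (fun x : E => x - z) μ μ := measurePreserving_sub_right μ z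
  have hemb : MeasurableEmbedding (fun x : E => x - z) := measurableEmbedding_subRight z
  have := hmp.setLIntegral_comp_preimage_emb hemb (fun x => ENNReal.ofReal (‖x‖ ^ (-γ)))
    ((fun x : E => x - z) '' s)
  rw [preimage_image_eq _ hemb.injective] at this
  rw [this]
  refine (h _).trans (le_of_eq ?_)
  rw [← hmp.measure_preimage_emb hemb, preimage_image_eq _ hemb.injective]

section RieszKernel

variable {E : Type*} [NormedAddCommGroup E] [NormedSpace ℝ E] [FiniteDimensional ℝ E]
  [MeasurableSpace E] [BorelSpace E] (μ : Measure E) [μ.IsAddHaarMeasure]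

lemma exists_setLIntegral_ball_norm_rpow_le (hd : 1 ≤ Module.finrank ℝ E) {γ : ℝ}
    (hγ : γ < Module.finrank ℝ E) :
    ∃ c : ℝ≥0∞, c ≠ ∞ ∧ ∀ R : ℝ, 0 < R →
      ∫⁻ x in Metric.ball (0 : E) R, ENNReal.ofReal (‖x‖ ^ (-γ)) ∂μ
        ≤ c * ENNReal.ofReal (R ^ (Module.finrank ℝ E - γ)) := by
  have hint : ∀ r : ℝ, IntegrableOn (fun x : E => ‖x‖ ^ (-γ)) (Metric.ball 0 r) μ := fun r =>
    integrableOn_ball_of_norm_le_rpow (C := 1) hd hγ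
      (Eventually.of_forall fun x => by
        rw [one_mul, Real.norm_of_nonneg (Real.rpow_nonneg (norm_nonneg x) _)])
      (by fun_prop : Measurable fun x : E => ‖x‖ ^ (-γ)).aestronglyMeasurable
  refine ⟨ENNReal.ofReal (∫ x in Metric.ball (0 : E) 1, ‖x‖ ^ (-γ) ∂μ), ENNReal.ofReal_ne_top,
    fun R hR => ?_⟩
  have hscale := Measure.setIntegral_comp_smul_of_pos μ (fun x : E => ‖x‖ ^ (-γ))
    (Metric.ball (0 : E) 1) hR
  rw [smul_unitBall_of_pos hR] at hscale
  have hhom : ∀ x : E, ‖R • x‖ ^ (-γ) = R ^ (-γ) * ‖x‖ ^ (-γ) := fun x => by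
    rw [norm_smul, Real.norm_of_nonneg hR.le, Real.mul_rpow hR.le (norm_nonneg x)]
  simp only [hhom] at hscale
  rw [integral_const_mul, smul_eq_mul] at hscale
  have hpow : (0 : ℝ) < R ^ Module.finrank ℝ E := pow_pos hR _
  rw [← ofReal_integral_eq_lintegral_ofReal (hint R)
    (Eventually.of_forall fun x => Real.rpow_nonneg (norm_nonneg x) _),
    ← ENNReal.ofReal_mul (integral_nonneg fun x => Real.rpow_nonneg (norm_nonneg x) _)]
  apply ENNReal.ofReal_le_ofReal
  rw [sub_eq_add_neg, Real.rpow_add hR, Real.rpow_natCast]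
  have hball : ∫ x in Metric.ball (0 : E) R, ‖x‖ ^ (-γ) ∂μ
      = R ^ Module.finrank ℝ E * (R ^ (-γ) * ∫ x in Metric.ball (0 : E) 1, ‖x‖ ^ (-γ) ∂μ) := by
    rw [hscale]; field_simp
  rw [hball]
  exact le_of_eq (by ring)

lemma exists_setLIntegral_norm_rpow_le (hd : 1 ≤ Module.finrank ℝ E) {γ : ℝ} (hγ0 : 0 ≤ γ)
    (hγ : γ < Module.finrank ℝ E) :
    ∃ c : ℝ≥0∞, c ≠ ∞ ∧ ∀ s : Set E,
      ∫⁻ x in s, ENNReal.ofReal (‖x‖ ^ (-γ)) ∂μ ≤ c * μ s ^ (1 - γ / Module.finrank ℝ E) := by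
  obtain ⟨c, hc, hball⟩ := exists_setLIntegral_ball_norm_rpow_le μ hd hγ
  have hn : (0 : ℝ) < Module.finrank ℝ E := by exact_mod_cast hd
  have he : 0 < 1 - γ / Module.finrank ℝ E := by
    rw [sub_pos, div_lt_one hn]; exact hγ
  refine ⟨c + 1, by simp [hc], fun s => ?_⟩
  rcases eq_or_ne (μ s) ∞ with hs | hs
  · rw [hs, ENNReal.top_rpow_of_pos he, ENNReal.mul_top (by simp)]
    exact le_top
  rcases eq_or_ne (μ s) 0 with hs0 | hs0
  · rw [Measure.restrict_eq_zero.2 hs0]; simp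
  set m := (μ s).toReal with hm
  have hm0 : 0 < m := ENNReal.toReal_pos hs0 hs
  have hmeas : μ s = ENNReal.ofReal m := (ENNReal.ofReal_toReal hs).symm
  set R := m ^ (1 / (Module.finrank ℝ E : ℝ)) with hR
  have hR0 : 0 < R := Real.rpow_pos_of_pos hm0 _
  have hRpow : ∀ e : ℝ, R ^ e = m ^ (e / Module.finrank ℝ E) := fun e => by
    rw [hR, ← Real.rpow_mul hm0.le]; congr 1; ring
  calc ∫⁻ x in s, ENNReal.ofReal (‖x‖ ^ (-γ)) ∂μ
      ≤ ∫⁻ x in s, ((Metric.ball (0 : E) R).indicator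
          (fun x => ENNReal.ofReal (‖x‖ ^ (-γ))) x + ENNReal.ofReal (R ^ (-γ))) ∂μ := by
        refine lintegral_mono fun x => ?_
        by_cases hx : x ∈ Metric.ball (0 : E) R
        · simp only [indicator_of_mem hx]; exact le_self_add
        · simp only [indicator_of_notMem hx, zero_add]
          apply ENNReal.ofReal_le_ofReal
          exact Real.rpow_le_rpow_of_nonpos hR0 (by simpa using hx) (by linarith)
    _ = ∫⁻ x in s, (Metric.ball (0 : E) R).indicator
          (fun x => ENNReal.ofReal (‖x‖ ^ (-γ))) x ∂μ + ENNReal.ofReal (R ^ (-γ)) * μ s := by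
        rw [lintegral_add_right _ measurable_const, setLIntegral_const]
    _ ≤ c * ENNReal.ofReal (R ^ (Module.finrank ℝ E - γ)) + ENNReal.ofReal (R ^ (-γ)) * μ s := by
        gcongr
        refine le_trans (setLIntegral_le_lintegral s _) ?_
        rw [lintegral_indicator Metric.isOpen_ball.measurableSet]
        exact hball R hR0
    _ = (c + 1) * μ s ^ (1 - γ / Module.finrank ℝ E) := by
        rw [hmeas, ← ENNReal.ofReal_mul (Real.rpow_nonneg hR0.le _),
          ENNReal.ofReal_rpow_of_pos hm0, hRpow, hRpow]
        have h1 : m ^ (-γ / (Module.finrank ℝ E : ℝ)) * m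
            = m ^ (1 - γ / (Module.finrank ℝ E : ℝ)) := by
          rw [← Real.rpow_add_one hm0.ne']; congr 1; ring
        have h2 : ((Module.finrank ℝ E : ℝ) - γ) / Module.finrank ℝ E
            = 1 - γ / Module.finrank ℝ E := by field_simp
        rw [h1, h2]; ring

lemma rpow_neg_mul_rpow_neg_le {a b β lam : ℝ} (ha : 0 ≤ a) (hb : 0 ≤ b) (hβ : 0 ≤ β)
    (hlam : 0 < lam) : a ^ (-β) * b ^ (-lam) ≤ a ^ (-(β + lam)) + b ^ (-(β + lam)) := by
  rcases hb.eq_or_lt with rfl | hb'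
  · rw [Real.zero_rpow (by linarith : -lam ≠ 0), mul_zero]
    positivity
  rcases ha.eq_or_lt with rfl | ha'
  · rcases hβ.eq_or_lt with rfl | hβ'
    · simp [Real.zero_rpow (by linarith : -lam ≠ 0)]
    · rw [Real.zero_rpow (by linarith : -β ≠ 0), zero_mul]
      positivity
  rw [neg_add, Real.rpow_add ha', Real.rpow_add hb']
  rcases le_total a b with h | h
  · have := Real.rpow_le_rpow_of_nonpos ha' h (by linarith : -lam ≤ 0)
    have h2 : a ^ (-β) * b ^ (-lam) ≤ a ^ (-β) * a ^ (-lam) := by gcongr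
    have : 0 ≤ b ^ (-β) * b ^ (-lam) := by positivity
    linarith
  · have := Real.rpow_le_rpow_of_nonpos hb' h (by linarith : -β ≤ 0)
    have h2 : a ^ (-β) * b ^ (-lam) ≤ b ^ (-β) * b ^ (-lam) := by gcongr
    have : 0 ≤ a ^ (-β) * a ^ (-lam) := by positivity
    linarith

lemma exists_setLIntegral_norm_rpow_mul_norm_sub_rpow_le (hd : 1 ≤ Module.finrank ℝ E)
    {β lam : ℝ} (hβ : 0 ≤ β) (hlam : 0 < lam) (h : β + lam < Module.finrank ℝ E) :
    ∃ c : ℝ≥0∞, c ≠ ∞ ∧ ∀ (s : Set E) (y : E),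
      ∫⁻ x in s, ENNReal.ofReal (‖x‖ ^ (-β)) * ENNReal.ofReal (‖x - y‖ ^ (-lam)) ∂μ
        ≤ c * μ s ^ (1 - (β + lam) / Module.finrank ℝ E) := by
  obtain ⟨c, hc, hs⟩ := exists_setLIntegral_norm_rpow_le μ hd (by positivity) h
  refine ⟨c + c, by simp [hc], fun s y => ?_⟩
  calc _ ≤ ∫⁻ x in s, (ENNReal.ofReal (‖x‖ ^ (-(β + lam)))
        + ENNReal.ofReal (‖x - y‖ ^ (-(β + lam)))) ∂μ := by
        refine lintegral_mono fun x => ?_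
        rw [← ENNReal.ofReal_mul (by positivity), ← ENNReal.ofReal_add (by positivity)
          (by positivity)]
        exact ENNReal.ofReal_le_ofReal
          (rpow_neg_mul_rpow_neg_le (norm_nonneg _) (norm_nonneg _) hβ hlam)
    _ ≤ _ := by
        rw [lintegral_add_left (by fun_prop), add_mul]
        exact add_le_add (hs s) (setLIntegral_norm_sub_rpow_le μ hs s y)

@[fun_prop]
lemma measurable_rieszKernel (α β lam : ℝ) :
    Measurable (fun z : E × E => rieszKernel α β lam z.1 z.2) := by
  unfold rieszKernel; fun_prop

lemma exists_lintegral_rieszKernel_le (hd : 1 ≤ Module.finrank ℝ E)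
    {α β lam : ℝ} (hα : 0 ≤ α) (hβ : 0 ≤ β) (hlam : 0 < lam)
    (h1 : α < Module.finrank ℝ E) (h2 : β + lam < Module.finrank ℝ E) :
    ∃ c : ℝ≥0∞, c ≠ ∞ ∧ ∀ s t : Set E,
      ∫⁻ y in t, ∫⁻ x in s, rieszKernel α β lam x y ∂μ ∂μ
        ≤ c * (μ t ^ (1 - α / Module.finrank ℝ E)
          * μ s ^ (1 - (β + lam) / Module.finrank ℝ E)) := by
  obtain ⟨c, hc, hs⟩ := exists_setLIntegral_norm_rpow_mul_norm_sub_rpow_le μ hd hβ hlam h2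
  obtain ⟨c', hc', ht⟩ := exists_setLIntegral_norm_rpow_le μ hd hα h1
  refine ⟨c' * c, ENNReal.mul_ne_top hc' hc, fun s t => ?_⟩
  calc _ ≤ ∫⁻ y in t, ENNReal.ofReal (‖y‖ ^ (-α))
        * (c * μ s ^ (1 - (β + lam) / Module.finrank ℝ E)) ∂μ := by
        refine lintegral_mono fun y => ?_
        refine le_trans (le_of_eq ?_) (mul_le_mul_right (hs s y) _)
        rw [← lintegral_const_mul _ (by fun_prop)]
        refine lintegral_congr fun x => ?_
        rw [rieszKernel]; ring
    _ ≤ _ := by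
        rw [lintegral_mul_const _ (by fun_prop)]
        refine (mul_le_mul_left (ht t) _).trans (le_of_eq ?_)
        ring

/-- Restricted weak type bounds for the weighted Riesz kernel at both endpoints. -/
lemma exists_lintegral_rieszKernel_le_and_le (hd : 1 ≤ Module.finrank ℝ E)
    {α β lam : ℝ} (hα : 0 ≤ α) (hβ : 0 ≤ β) (hlam : 0 < lam)
    (h1 : α + lam < Module.finrank ℝ E) (h2 : β + lam < Module.finrank ℝ E) :
    ∃ c : ℝ≥0∞, c ≠ ∞ ∧ ∀ s t : Set E,
      ∫⁻ y in t, ∫⁻ x in s, rieszKernel α β lam x y ∂μ ∂μ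
        ≤ c * (μ t ^ (1 - α / Module.finrank ℝ E)
          * μ s ^ (1 - (β + lam) / Module.finrank ℝ E)) ∧
      ∫⁻ y in t, ∫⁻ x in s, rieszKernel α β lam x y ∂μ ∂μ
        ≤ c * (μ s ^ (1 - β / Module.finrank ℝ E)
          * μ t ^ (1 - (α + lam) / Module.finrank ℝ E)) := by
  obtain ⟨c, hc, h⟩ := exists_lintegral_rieszKernel_le μ hd hα hβ hlam (by linarith) h2
  obtain ⟨c', hc', h'⟩ := exists_lintegral_rieszKernel_le μ hd hβ hα hlam (by linarith) h1
  refine ⟨c + c', ENNReal.add_ne_top.2 ⟨hc, hc'⟩, fun s t => ⟨(h s t).trans ?_, ?_⟩⟩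
  · gcongr; exact le_self_add
  · rw [lintegral_lintegral_swap (by fun_prop)]
    simp only [rieszKernel_swap α β]
    refine (h' t s).trans ?_
    gcongr; exact le_add_self

end RieszKernel

lemma setLIntegral_Ioc_rpow_sub_one {e s : ℝ} (he : 0 < e) (hs : 0 ≤ s) :
    ∫⁻ t in Ioc 0 s, ENNReal.ofReal (t ^ (e - 1)) = ENNReal.ofReal (s ^ e / e) := by
  have hint : IntegrableOn (fun t : ℝ => t ^ (e - 1)) (Ioc 0 s) :=
    (intervalIntegrable_iff_integrableOn_Ioc_of_le hs).1
      (intervalIntegral.intervalIntegrable_rpow' (by linarith))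
  rw [← ofReal_integral_eq_lintegral_ofReal hint, ← intervalIntegral.integral_of_le hs,
    integral_rpow (Or.inl (by linarith))]
  · simp [Real.zero_rpow he.ne']
  · filter_upwards [ae_restrict_mem measurableSet_Ioc] with t ht
    exact Real.rpow_nonneg ht.1.le _

lemma setLIntegral_Ici_rpow_neg_sub_one {e t : ℝ} (he : 0 < e) (ht : 0 < t) :
    ∫⁻ s in Ici t, ENNReal.ofReal (s ^ (-e - 1)) = ENNReal.ofReal (t ^ (-e) / e) := by
  rw [setLIntegral_congr Ioi_ae_eq_Ici.symm,
    ← ofReal_integral_eq_lintegral_ofReal (integrableOn_Ioi_rpow_of_lt (by linarith) ht),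
    integral_Ioi_rpow_of_lt (by linarith) ht]
  · congr 1
    rw [show -e - 1 + 1 = -e by ring, neg_div_neg_eq]
  · filter_upwards [ae_restrict_mem measurableSet_Ioi] with s hs
    exact Real.rpow_nonneg (ht.trans hs).le _

lemma lintegral_triangle_left {v : ℝ → ℝ≥0∞} (hv : Measurable v) {e : ℝ} (he : 0 < e) :
    ∫⁻ z in {z : ℝ × ℝ | z.2 ≤ z.1}, v z.1 * ENNReal.ofReal (z.1 ^ (-e) * z.2 ^ (e - 1))
      ∂((volume.restrict (Ioi 0)).prod (volume.restrict (Ioi 0)))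
      = (∫⁻ s in Ioi 0, v s) * ENNReal.ofReal (1 / e) := by
  have hT : MeasurableSet {z : ℝ × ℝ | z.2 ≤ z.1} := measurableSet_le measurable_snd measurable_fst
  rw [← lintegral_indicator hT,
    lintegral_prod _ ((by fun_prop : Measurable _).indicator hT).aemeasurable,
    ← lintegral_mul_const _ hv]
  refine setLIntegral_congr_fun measurableSet_Ioi fun s (hs : 0 < s) => ?_
  have hind : ∀ t : ℝ, ({z : ℝ × ℝ | z.2 ≤ z.1}.indicator
      (fun z => v z.1 * ENNReal.ofReal (z.1 ^ (-e) * z.2 ^ (e - 1))) (s, t))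
      = (Iic s).indicator (fun t => v s * ENNReal.ofReal (s ^ (-e))
          * ENNReal.ofReal (t ^ (e - 1))) t := by
    intro t
    by_cases h : t ≤ s
    · rw [indicator_of_mem (by exact h), indicator_of_mem (by exact h),
        ENNReal.ofReal_mul (Real.rpow_nonneg hs.le _), mul_assoc]
    · rw [indicator_of_notMem (by exact h), indicator_of_notMem (by exact h)]
  simp only [hind]
  rw [lintegral_indicator measurableSet_Iic, Measure.restrict_restrict measurableSet_Iic,
    inter_comm, Ioi_inter_Iic, lintegral_const_mul _ (by fun_prop),
    setLIntegral_Ioc_rpow_sub_one he hs.le, mul_assoc, ← ENNReal.ofReal_mul (by positivity)]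
  congr 2
  rw [Real.rpow_neg hs.le]; field_simp

lemma lintegral_triangle_right {w : ℝ → ℝ≥0∞} (hw : Measurable w) {e : ℝ} (he : 0 < e) :
    ∫⁻ z in {z : ℝ × ℝ | z.2 ≤ z.1}, w z.2 * ENNReal.ofReal (z.1 ^ (-e - 1) * z.2 ^ e)
      ∂((volume.restrict (Ioi 0)).prod (volume.restrict (Ioi 0)))
      = (∫⁻ t in Ioi 0, w t) * ENNReal.ofReal (1 / e) := by
  have hT : MeasurableSet {z : ℝ × ℝ | z.2 ≤ z.1} := measurableSet_le measurable_snd measurable_fst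
  rw [← lintegral_indicator hT,
    lintegral_prod_symm _ ((by fun_prop : Measurable _).indicator hT).aemeasurable,
    ← lintegral_mul_const _ hw]
  refine setLIntegral_congr_fun measurableSet_Ioi fun t (ht : 0 < t) => ?_
  have hind : ∀ s : ℝ, ({z : ℝ × ℝ | z.2 ≤ z.1}.indicator
      (fun z => w z.2 * ENNReal.ofReal (z.1 ^ (-e - 1) * z.2 ^ e)) (s, t))
      = (Ici t).indicator (fun s => w t * ENNReal.ofReal (t ^ e)
          * ENNReal.ofReal (s ^ (-e - 1))) s := by
    intro s
    by_cases h : t ≤ s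
    · rw [indicator_of_mem (by exact h), indicator_of_mem (by exact h), mul_comm (s ^ _),
        ENNReal.ofReal_mul (Real.rpow_nonneg ht.le _), mul_assoc]
    · rw [indicator_of_notMem (by exact h), indicator_of_notMem (by exact h)]
  simp only [hind]
  rw [lintegral_indicator measurableSet_Ici, Measure.restrict_restrict measurableSet_Ici,
    inter_eq_left.2 (Ici_subset_Ioi.2 ht), lintegral_const_mul _ (by fun_prop),
    setLIntegral_Ici_rpow_neg_sub_one he ht, mul_assoc, ← ENNReal.ofReal_mul (by positivity)]
  congr 2
  rw [Real.rpow_neg ht.le]; field_simp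

/-- A Hardy-type inequality: the trilinear Young inequality for the kernel `e^{-ε(s-t)} 1_{t ≤ s}`
written in multiplicative variables. -/
lemma lintegral_triangle_le {v w : ℝ → ℝ≥0∞} (hv : Measurable v) (hw : Measurable w)
    {A B κ ε : ℝ} (hA : A ≤ 1) (hB : B ≤ 1) (hκ0 : 0 < κ) (hκ1 : κ ≤ 1) (hAB : A + B = 2 - κ)
    (hε : 0 < ε) :
    ∫⁻ z in {z : ℝ × ℝ | z.2 ≤ z.1}, v z.1 ^ A * w z.2 ^ B
        * ENNReal.ofReal (z.1 ^ (A - ε - 1) * z.2 ^ (B + ε - 1))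
      ∂((volume.restrict (Ioi 0)).prod (volume.restrict (Ioi 0)))
      ≤ (∫⁻ s in Ioi 0, v s) ^ A * (∫⁻ t in Ioi 0, w t) ^ B
        * ENNReal.ofReal ((κ / ε) ^ κ) := by
  have hT : MeasurableSet {z : ℝ × ℝ | z.2 ≤ z.1} := measurableSet_le measurable_snd measurable_fst
  set ν : Measure ℝ := volume.restrict (Ioi 0) with hν
  set e := ε / κ with he_def
  have he : 0 < e := div_pos hε hκ0
  have heκ : e * κ = ε := div_mul_cancel₀ _ hκ0.ne'
  let g : Fin 3 → ℝ × ℝ → ℝ≥0∞ := ![fun z => v z.1 * w z.2,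
    fun z => v z.1 * ENNReal.ofReal (z.1 ^ (-e) * z.2 ^ (e - 1)),
    fun z => w z.2 * ENNReal.ofReal (z.1 ^ (-e - 1) * z.2 ^ e)]
  let r : Fin 3 → ℝ := ![1 - κ, 1 - B, 1 - A]
  have hg : ∀ i ∈ Finset.univ, AEMeasurable (g i)
      ((ν.prod ν).restrict {z : ℝ × ℝ | z.2 ≤ z.1}) := by
    intro i _
    apply Measurable.aemeasurable
    fin_cases i <;> simp [g] <;> fun_prop
  have hr : ∑ i, r i = 1 := by simp [r, Fin.sum_univ_three]; linarith
  have hr0 : ∀ i ∈ Finset.univ, 0 ≤ r i := by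
    intro i _
    fin_cases i <;> simp [r, *]
  have holder := ENNReal.lintegral_prod_norm_pow_le Finset.univ hg hr hr0
  simp only [Fin.prod_univ_three] at holder
  have hint0 : ∫⁻ z in {z : ℝ × ℝ | z.2 ≤ z.1}, g 0 z ∂(ν.prod ν)
      ≤ (∫⁻ s, v s ∂ν) * ∫⁻ t, w t ∂ν := by
    refine (setLIntegral_le_lintegral _ _).trans (le_of_eq ?_)
    exact lintegral_prod_mul hv.aemeasurable hw.aemeasurable
  have hint1 : ∫⁻ z in {z : ℝ × ℝ | z.2 ≤ z.1}, g 1 z ∂(ν.prod ν)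
      = (∫⁻ s, v s ∂ν) * ENNReal.ofReal (1 / e) := lintegral_triangle_left hv he
  have hint2 : ∫⁻ z in {z : ℝ × ℝ | z.2 ≤ z.1}, g 2 z ∂(ν.prod ν)
      = (∫⁻ t, w t ∂ν) * ENNReal.ofReal (1 / e) := lintegral_triangle_right hw he
  have hpos : ∀ᵐ z ∂(ν.prod ν), 0 < z.1 ∧ 0 < z.2 := by
    rw [hν, Measure.prod_restrict]
    filter_upwards [ae_restrict_mem (measurableSet_Ioi.prod measurableSet_Ioi)] with z hz
    exact hz
  have hA0 : 0 ≤ 1 - A := by linarith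
  have hB0 : 0 ≤ 1 - B := by linarith
  have hκ0' : 0 ≤ 1 - κ := by linarith
  calc _ = ∫⁻ z in {z : ℝ × ℝ | z.2 ≤ z.1}, g 0 z ^ r 0 * g 1 z ^ r 1 * g 2 z ^ r 2
        ∂(ν.prod ν) := by
        refine lintegral_congr_ae ?_
        filter_upwards [ae_restrict_of_ae hpos] with z ⟨h1, h2⟩
        simp only [g, r, Matrix.cons_val_zero, Matrix.cons_val_one, Matrix.cons_val]
        rw [ENNReal.mul_rpow_of_nonneg _ _ hκ0', ENNReal.mul_rpow_of_nonneg _ _ hB0,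
          ENNReal.mul_rpow_of_nonneg _ _ hA0, ENNReal.ofReal_rpow_of_nonneg (by positivity) hB0,
          ENNReal.ofReal_rpow_of_nonneg (by positivity) hA0]
        have hvA : v z.1 ^ A = v z.1 ^ (1 - κ) * v z.1 ^ (1 - B) := by
          rw [← ENNReal.rpow_add_of_nonneg _ _ hκ0' hB0]; congr 1; linarith
        have hwB : w z.2 ^ B = w z.2 ^ (1 - κ) * w z.2 ^ (1 - A) := by
          rw [← ENNReal.rpow_add_of_nonneg _ _ hκ0' hA0]; congr 1; linarith
        have hk : z.1 ^ (A - ε - 1) * z.2 ^ (B + ε - 1)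
            = (z.1 ^ (-e) * z.2 ^ (e - 1)) ^ (1 - B)
              * (z.1 ^ (-e - 1) * z.2 ^ e) ^ (1 - A) := by
          rw [Real.mul_rpow (by positivity) (by positivity),
            Real.mul_rpow (by positivity) (by positivity), ← Real.rpow_mul h1.le,
            ← Real.rpow_mul h1.le, ← Real.rpow_mul h2.le, ← Real.rpow_mul h2.le,
            mul_mul_mul_comm, ← Real.rpow_add h1, ← Real.rpow_add h2]
          have hκ' : κ = 2 - A - B := by linarith
          congr 2
          · rw [← heκ, hκ']; ring
          · rw [← heκ, hκ']; ring
        rw [hvA, hwB, hk, ENNReal.ofReal_mul (by positivity)]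
        ring
    _ ≤ _ := holder
    _ ≤ ((∫⁻ s, v s ∂ν) * ∫⁻ t, w t ∂ν) ^ (1 - κ)
        * ((∫⁻ s, v s ∂ν) * ENNReal.ofReal (1 / e)) ^ (1 - B)
        * ((∫⁻ t, w t ∂ν) * ENNReal.ofReal (1 / e)) ^ (1 - A) := by
        rw [hint1, hint2]
        exact mul_le_mul' (mul_le_mul' (ENNReal.rpow_le_rpow hint0 hκ0') le_rfl) le_rfl
    _ = _ := by
        rw [ENNReal.mul_rpow_of_nonneg _ _ hκ0', ENNReal.mul_rpow_of_nonneg _ _ hB0,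
          ENNReal.mul_rpow_of_nonneg _ _ hA0, ENNReal.ofReal_rpow_of_nonneg (by positivity) hB0,
          ENNReal.ofReal_rpow_of_nonneg (by positivity) hA0]
        have hvA : (∫⁻ s, v s ∂ν) ^ A = (∫⁻ s, v s ∂ν) ^ (1 - κ) * (∫⁻ s, v s ∂ν) ^ (1 - B) := by
          rw [← ENNReal.rpow_add_of_nonneg _ _ hκ0' hB0]; congr 1; linarith
        have hwB : (∫⁻ s, w s ∂ν) ^ B = (∫⁻ s, w s ∂ν) ^ (1 - κ) * (∫⁻ s, w s ∂ν) ^ (1 - A) := by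
          rw [← ENNReal.rpow_add_of_nonneg _ _ hκ0' hA0]; congr 1; linarith
        have hk : (κ / ε) ^ κ = (1 / e) ^ (1 - B) * (1 / e) ^ (1 - A) := by
          rw [← Real.rpow_add (by positivity), he_def, one_div_div]; congr 1; linarith
        rw [hvA, hwB, hk, ENNReal.ofReal_mul (by positivity)]
        ring

lemma lintegral_ofReal_rpow_mul_eq_lintegral_superlevel {E : Type*} [MeasurableSpace E]
    (μ : Measure E) [SFinite μ] {F : E → ℝ} (hF : Measurable F) (hF0 : ∀ y, 0 ≤ F y)
    {k : E → ℝ≥0∞} (hk : Measurable k) {a : ℝ} (ha : 0 < a) :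
    ∫⁻ y, ENNReal.ofReal (F y ^ a) * k y ∂μ
      = ENNReal.ofReal a * ∫⁻ s in Ioi 0, ENNReal.ofReal (s ^ (a - 1))
          * ∫⁻ y in {y | s ≤ F y}, k y ∂μ := by
  have hT : MeasurableSet {z : E × ℝ | z.2 ≤ F z.1} :=
    measurableSet_le measurable_snd (hF.comp measurable_fst)
  set G : E → ℝ → ℝ≥0∞ := fun y s => {z : E × ℝ | z.2 ≤ F z.1}.indicator
    (fun z => ENNReal.ofReal (z.2 ^ (a - 1)) * k z.1) (y, s) with hG
  have hGm : Measurable (Function.uncurry G) :=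
    (by fun_prop : Measurable fun z : E × ℝ =>
      ENNReal.ofReal (z.2 ^ (a - 1)) * k z.1).indicator hT
  have hy : ∀ y, ENNReal.ofReal (F y ^ a) * k y = ENNReal.ofReal a * ∫⁻ s in Ioi 0, G y s := by
    intro y
    have hind : ∀ s, G y s
        = (Iic (F y)).indicator (fun s => ENNReal.ofReal (s ^ (a - 1)) * k y) s := fun s => by
      by_cases h : s ≤ F y
      · simp only [hG]; rw [indicator_of_mem (by exact h), indicator_of_mem (by exact h)]
      · simp only [hG]; rw [indicator_of_notMem (by exact h), indicator_of_notMem (by exact h)]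
    simp only [hind]
    rw [lintegral_indicator measurableSet_Iic, Measure.restrict_restrict measurableSet_Iic,
      inter_comm, Ioi_inter_Iic, lintegral_mul_const _ (by fun_prop),
      setLIntegral_Ioc_rpow_sub_one ha (hF0 y), ← mul_assoc, ← ENNReal.ofReal_mul ha.le]
    congr 2; field_simp
  have hs : ∀ s, ENNReal.ofReal (s ^ (a - 1)) * ∫⁻ y in {y | s ≤ F y}, k y ∂μ
      = ∫⁻ y, G y s ∂μ := by
    intro s
    have hind : ∀ y, G y s
        = {y | s ≤ F y}.indicator (fun y => ENNReal.ofReal (s ^ (a - 1)) * k y) y := fun y => by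
      by_cases h : s ≤ F y
      · simp only [hG]; rw [indicator_of_mem (by exact h), indicator_of_mem (by exact h)]
      · simp only [hG]; rw [indicator_of_notMem (by exact h), indicator_of_notMem (by exact h)]
    simp only [hind]
    rw [lintegral_indicator (measurableSet_le measurable_const hF), lintegral_const_mul _ hk]
  simp only [hy, hs]
  rw [lintegral_const_mul' _ _ ENNReal.ofReal_ne_top, lintegral_lintegral_swap hGm.aemeasurable]

lemma lintegral_bilinear_le_lintegral_superlevel {E : Type*} [MeasurableSpace E]
    (μ : Measure E) [SFinite μ] {F H : E → ℝ} (hF : Measurable F) (hF0 : ∀ y, 0 ≤ F y)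
    (hH : Measurable H) (hH0 : ∀ y, 0 ≤ H y) {K : E → E → ℝ≥0∞}
    (hK : Measurable (Function.uncurry K)) {a b : ℝ} (ha : 0 < a) (ha1 : a ≤ 1) (hb : 0 < b)
    (hb1 : b ≤ 1) :
    ∫⁻ x, ∫⁻ y, ENNReal.ofReal (H x ^ b) * (ENNReal.ofReal (F y ^ a) * K x y) ∂μ ∂μ
      ≤ ∫⁻ s in Ioi 0, ∫⁻ t in Ioi 0, ENNReal.ofReal (s ^ (a - 1)) * ENNReal.ofReal (t ^ (b - 1))
          * ∫⁻ y in {y | s ≤ F y}, ∫⁻ x in {x | t ≤ H x}, K x y ∂μ ∂μ := by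
  have hle : ∀ {r : ℝ}, r ≤ 1 → ∀ u : ℝ≥0∞, ENNReal.ofReal r * u ≤ u := fun hr u =>
    mul_le_of_le_one_left' (ENNReal.ofReal_le_one.2 hr)
  have hK' : Measurable fun z : E × E => K z.1 z.2 := hK
  have hkm : Measurable fun y => ∫⁻ x, ENNReal.ofReal (H x ^ b) * K x y ∂μ :=
    (by fun_prop : Measurable fun z : E × E =>
      ENNReal.ofReal (H z.1 ^ b) * K z.1 z.2).lintegral_prod_left'
  calc _ = ∫⁻ y, ENNReal.ofReal (F y ^ a) * ∫⁻ x, ENNReal.ofReal (H x ^ b) * K x y ∂μ ∂μ := by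
        rw [lintegral_lintegral_swap (by fun_prop)]
        refine lintegral_congr fun y => ?_
        rw [← lintegral_const_mul _ (by fun_prop)]
        exact lintegral_congr fun x => by ring
    _ ≤ ∫⁻ s in Ioi 0, ENNReal.ofReal (s ^ (a - 1))
          * ∫⁻ y in {y | s ≤ F y}, ∫⁻ x, ENNReal.ofReal (H x ^ b) * K x y ∂μ ∂μ := by
        rw [lintegral_ofReal_rpow_mul_eq_lintegral_superlevel μ hF hF0 hkm ha]
        exact hle ha1 _
    _ ≤ _ := by
        refine lintegral_mono fun s => ?_
        have hm : Measurable fun x => ∫⁻ y in {y | s ≤ F y}, K x y ∂μ := hK'.lintegral_prod_right'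
        have : ∫⁻ y in {y | s ≤ F y}, ∫⁻ x, ENNReal.ofReal (H x ^ b) * K x y ∂μ ∂μ
            ≤ ∫⁻ t in Ioi 0, ENNReal.ofReal (t ^ (b - 1))
              * ∫⁻ y in {y | s ≤ F y}, ∫⁻ x in {x | t ≤ H x}, K x y ∂μ ∂μ := by
          rw [lintegral_lintegral_swap (by fun_prop)]
          have hx : ∀ x, ∫⁻ y in {y | s ≤ F y}, ENNReal.ofReal (H x ^ b) * K x y ∂μ
              = ENNReal.ofReal (H x ^ b) * ∫⁻ y in {y | s ≤ F y}, K x y ∂μ := fun x =>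
            lintegral_const_mul _ (by fun_prop)
          simp only [hx]
          rw [lintegral_ofReal_rpow_mul_eq_lintegral_superlevel μ hH hH0 hm hb]
          refine (hle hb1 _).trans (le_of_eq (lintegral_congr fun t => ?_))
          rw [lintegral_lintegral_swap (by fun_prop)]
        refine (mul_le_mul_right this _).trans (le_of_eq ?_)
        rw [← lintegral_const_mul' _ _ ENNReal.ofReal_ne_top]
        exact lintegral_congr fun t => (mul_assoc _ _ _).symm

/-- Interpolation of two restricted weak type bounds, with explicit dependence of the constant
on the distances `ε`, `ε'` to the two endpoints. -/
lemma lintegral_bilinear_le {E : Type*} [MeasurableSpace E] (μ : Measure E) [SFinite μ]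
    {K : E → E → ℝ≥0∞} (hK : Measurable (Function.uncurry K)) {c : ℝ≥0∞}
    {A B A' B' κ ε ε' a b : ℝ}
    (hKle : ∀ s t : Set E,
      ∫⁻ y in t, ∫⁻ x in s, K x y ∂μ ∂μ ≤ c * (μ t ^ A * μ s ^ B) ∧
      ∫⁻ y in t, ∫⁻ x in s, K x y ∂μ ∂μ ≤ c * (μ s ^ B' * μ t ^ A'))
    (hA : A ≤ 1) (hB : B ≤ 1) (hA' : A' ≤ 1) (hB' : B' ≤ 1) (hκ0 : 0 < κ) (hκ1 : κ ≤ 1)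
    (hAB : A + B = 2 - κ) (hAB' : B' + A' = 2 - κ) (hε : 0 < ε) (hε' : 0 < ε')
    (haA : a = A - ε) (hbB : b = B + ε) (hbB' : b = B' - ε') (haA' : a = A' + ε')
    (ha : 0 < a) (hb : 0 < b)
    {F H : E → ℝ} (hF : Measurable F) (hF0 : ∀ y, 0 ≤ F y)
    (hH : Measurable H) (hH0 : ∀ y, 0 ≤ H y)
    (hF1 : ∫⁻ y, ENNReal.ofReal (F y) ∂μ ≤ 1) (hH1 : ∫⁻ x, ENNReal.ofReal (H x) ∂μ ≤ 1) :
    ∫⁻ x, ∫⁻ y, ENNReal.ofReal (H x ^ b) * (ENNReal.ofReal (F y ^ a) * K x y) ∂μ ∂μ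
      ≤ c * (ENNReal.ofReal ((κ / ε) ^ κ) + ENNReal.ofReal ((κ / ε') ^ κ)) := by
  set v : ℝ → ℝ≥0∞ := fun s => μ {y | s ≤ F y} with hv_def
  set w : ℝ → ℝ≥0∞ := fun t => μ {x | t ≤ H x} with hw_def
  have hv : Measurable v :=
    Antitone.measurable fun s s' h => measure_mono fun y hy => h.trans hy
  have hw : Measurable w :=
    Antitone.measurable fun s s' h => measure_mono fun y hy => h.trans hy
  have hv1 : ∫⁻ s in Ioi 0, v s ≤ 1 := by
    rwa [← lintegral_eq_lintegral_meas_le μ (Eventually.of_forall hF0) hF.aemeasurable]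
  have hw1 : ∫⁻ s in Ioi 0, w s ≤ 1 := by
    rwa [← lintegral_eq_lintegral_meas_le μ (Eventually.of_forall hH0) hH.aemeasurable]
  have hT : MeasurableSet {z : ℝ × ℝ | z.2 ≤ z.1} := measurableSet_le measurable_snd measurable_fst
  have hT' : MeasurableSet {z : ℝ × ℝ | z.1 ≤ z.2} := measurableSet_le measurable_fst measurable_snd
  set ν : Measure ℝ := volume.restrict (Ioi 0) with hν
  set g : ℝ × ℝ → ℝ≥0∞ := fun z => v z.1 ^ A * w z.2 ^ B
    * ENNReal.ofReal (z.1 ^ (A - ε - 1) * z.2 ^ (B + ε - 1)) with hg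
  set g' : ℝ × ℝ → ℝ≥0∞ := fun z => w z.1 ^ B' * v z.2 ^ A'
    * ENNReal.ofReal (z.1 ^ (B' - ε' - 1) * z.2 ^ (A' + ε' - 1)) with hg'
  have hgm : Measurable g := by fun_prop
  have hgm' : Measurable g' := by fun_prop
  have hone : ∀ {X Y : ℝ≥0∞} {p q : ℝ}, X ≤ 1 → Y ≤ 1 → 0 ≤ p → 0 ≤ q → ∀ u : ℝ≥0∞,
      X ^ p * Y ^ q * u ≤ u := fun hX hY hp hq u =>
    mul_le_of_le_one_left' (mul_le_one' (ENNReal.rpow_le_one hX hp) (ENNReal.rpow_le_one hY hq))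
  have hI1 : ∫⁻ z in {z : ℝ × ℝ | z.2 ≤ z.1}, g z ∂(ν.prod ν) ≤ ENNReal.ofReal ((κ / ε) ^ κ) :=
    (lintegral_triangle_le hv hw hA hB hκ0 hκ1 hAB hε).trans
      (hone hv1 hw1 (by linarith) (by linarith) _)
  have hI2 : ∫⁻ z in {z : ℝ × ℝ | z.1 ≤ z.2}, g' z.swap ∂(ν.prod ν)
      ≤ ENNReal.ofReal ((κ / ε') ^ κ) := by
    have hsw := (Measure.measurePreserving_swap (μ := ν) (ν := ν)).setLIntegral_comp_preimage
      hT hgm'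
    refine (le_of_eq hsw).trans ?_
    exact (lintegral_triangle_le hw hv hB' hA' hκ0 hκ1 hAB' hε').trans
      (hone hw1 hv1 (by linarith) (by linarith) _)
  set M : ℝ × ℝ → ℝ≥0∞ := fun z => {z : ℝ × ℝ | z.2 ≤ z.1}.indicator g z
    + {z : ℝ × ℝ | z.1 ≤ z.2}.indicator (fun z => g' z.swap) z with hM
  have hMm : Measurable M :=
    (hgm.indicator hT).add ((hgm'.comp measurable_swap).indicator hT')
  calc _ ≤ _ := lintegral_bilinear_le_lintegral_superlevel μ hF hF0 hH hH0 hK ha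
        (by linarith) hb (by linarith)
    _ ≤ ∫⁻ s, ∫⁻ t, c * M (s, t) ∂ν ∂ν := by
        refine setLIntegral_mono' measurableSet_Ioi fun s hs => ?_
        refine setLIntegral_mono' measurableSet_Ioi fun t ht => ?_
        have hs : 0 < s := hs
        have ht : 0 < t := ht
        obtain ⟨h1, h2⟩ := hKle {x | t ≤ H x} {y | s ≤ F y}
        rw [← ENNReal.ofReal_mul (by positivity)]
        rcases le_total t s with h | h
        · have hMle : g (s, t) ≤ M (s, t) := by
            simp only [hM]
            rw [indicator_of_mem (by exact h)]
            exact le_self_add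
          refine (mul_le_mul_right h1 _).trans ?_
          refine le_trans (le_of_eq ?_) (mul_le_mul_right hMle c)
          simp only [hg, hv_def, hw_def]
          rw [haA, show B + ε = b from hbB.symm]; ring
        · have hMle : g' (t, s) ≤ M (s, t) := by
            simp only [hM]
            rw [indicator_of_mem (s := {z : ℝ × ℝ | z.1 ≤ z.2}) (by exact h)]
            exact le_add_self
          refine (mul_le_mul_right h2 _).trans ?_
          refine le_trans (le_of_eq ?_) (mul_le_mul_right hMle c)
          simp only [hg', hv_def, hw_def]
          rw [hbB', show A' + ε' = a from haA'.symm, mul_comm (s ^ _)]; ring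
    _ = c * ∫⁻ z, M z ∂(ν.prod ν) := by
        rw [← lintegral_const_mul _ hMm, lintegral_prod _ (hMm.const_mul c).aemeasurable]
    _ ≤ _ := by
        rw [lintegral_add_left (hgm.indicator hT), lintegral_indicator hT, lintegral_indicator hT']
        gcongr

/-- A dual characterization of `L^q` bounds with test functions of the form `H ^ (1 - 1/q)`. -/
lemma lintegral_rpow_le_of_forall_lintegral_mul_le {E : Type*} [MeasurableSpace E] (μ : Measure E)
    [SigmaFinite μ] {u : E → ℝ≥0∞} {D : ℝ≥0∞} {q : ℝ} (hq : 0 < q)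
    (h : ∀ H : E → ℝ, Measurable H → (∀ x, 0 ≤ H x) → ∫⁻ x, ENNReal.ofReal (H x) ∂μ ≤ 1 →
      ∫⁻ x, ENNReal.ofReal (H x ^ (1 - 1 / q)) * u x ∂μ ≤ D) :
    ∫⁻ x, u x ^ q ∂μ ≤ D ^ q := by
  by_contra! hlt
  rw [lintegral_eq_nnreal] at hlt
  simp only [lt_iSup_iff] at hlt
  obtain ⟨Φ₀, hΦ₀, hlt⟩ := hlt
  rw [← SimpleFunc.lintegral_eq_lintegral] at hlt
  obtain ⟨Φ, hΦ, hfin, hlt⟩ := exists_lt_lintegral_simpleFunc_of_lt_lintegral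
    (f := fun x => Φ₀ x) (L := D ^ q) (μ := μ) (by simpa using hlt)
  set m := (∫⁻ x, Φ x ∂μ).toReal with hm
  have hmE : ∫⁻ x, Φ x ∂μ = ENNReal.ofReal m := (ENNReal.ofReal_toReal hfin.ne).symm
  have hm0 : 0 < m := ENNReal.toReal_pos ((zero_le).trans_lt hlt).ne' hfin.ne
  have hcoe : ∀ x, ENNReal.ofReal (Φ x : ℝ) = Φ x := fun x => ENNReal.ofReal_coe_nnreal
  have hΦm : Measurable fun x => (Φ x : ℝ) := Φ.measurable.coe_nnreal_real
  have key := h (fun x => Φ x / m) (hΦm.div_const m) (fun x => by positivity) (by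
    simp only [div_eq_mul_inv]
    simp only [ENNReal.ofReal_mul (NNReal.coe_nonneg _), hcoe]
    rw [lintegral_mul_const _ Φ.measurable.coe_nnreal_ennreal, hmE,
      ← ENNReal.ofReal_mul hm0.le, mul_inv_cancel₀ hm0.ne', ENNReal.ofReal_one])
  have hpt : ∀ x, (Φ x : ℝ≥0∞) * ENNReal.ofReal (m ^ (-(1 - 1 / q)))
      ≤ ENNReal.ofReal ((Φ x / m) ^ (1 - 1 / q)) * u x := by
    intro x
    have hu : ENNReal.ofReal ((Φ x : ℝ) ^ (1 / q)) ≤ u x := by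
      rw [← ENNReal.ofReal_rpow_of_nonneg (NNReal.coe_nonneg _) (by positivity), hcoe]
      have : (Φ x : ℝ≥0∞) ≤ u x ^ q := (ENNReal.coe_le_coe.2 (hΦ x)).trans (hΦ₀ x)
      rwa [one_div, ENNReal.rpow_inv_le_iff hq]
    refine le_trans (le_of_eq ?_) (mul_le_mul_right hu _)
    rw [← hcoe, ← ENNReal.ofReal_mul (NNReal.coe_nonneg _), ← ENNReal.ofReal_mul (by positivity)]
    congr 1
    rw [Real.div_rpow (NNReal.coe_nonneg _) hm0.le, Real.rpow_neg hm0.le, div_mul_eq_mul_div,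
      ← Real.rpow_add' (NNReal.coe_nonneg _) (by simp), sub_add_cancel,
      Real.rpow_one, ← div_eq_mul_inv]
  have hmD : ENNReal.ofReal (m ^ (1 / q)) ≤ D := by
    refine le_trans (le_of_eq ?_) ((lintegral_mono hpt).trans key)
    rw [lintegral_mul_const _ Φ.measurable.coe_nnreal_ennreal, hmE, ← ENNReal.ofReal_mul hm0.le]
    congr 1
    nth_rewrite 2 [← Real.rpow_one m]
    rw [← Real.rpow_add hm0]
    congr 1; ring
  refine hlt.not_ge ?_
  rw [hmE]
  rwa [← ENNReal.ofReal_rpow_of_pos hm0, one_div, ENNReal.rpow_inv_le_iff hq] at hmD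

/-- The bilinear bound for normalized functions gives the `L^p → L^q` bound. -/
lemma lintegral_kernel_rpow_le {E : Type*} [MeasurableSpace E] (μ : Measure E)
    [SigmaFinite μ] {K : E → E → ℝ≥0∞} (hK : Measurable (Function.uncurry K)) {D : ℝ≥0∞}
    (hD : D ≠ 0) {p q : ℝ} (hp : 0 < p) (hq : 0 < q)
    (h : ∀ F H : E → ℝ, Measurable F → (∀ y, 0 ≤ F y) → Measurable H → (∀ x, 0 ≤ H x) →
      ∫⁻ y, ENNReal.ofReal (F y) ∂μ ≤ 1 → ∫⁻ x, ENNReal.ofReal (H x) ∂μ ≤ 1 →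
      ∫⁻ x, ∫⁻ y, ENNReal.ofReal (H x ^ (1 - 1 / q)) * (ENNReal.ofReal (F y ^ (1 / p)) * K x y)
        ∂μ ∂μ ≤ D)
    {f : E → ℝ} (hf : Measurable f) :
    (∫⁻ x, (∫⁻ y, ‖f y‖ₑ * K x y ∂μ) ^ q ∂μ) ^ (1 / q)
      ≤ D * (∫⁻ y, ‖f y‖ₑ ^ p ∂μ) ^ (1 / p) := by
  have hK' : Measurable fun z : E × E => K z.1 z.2 := hK
  set N := ∫⁻ y, ‖f y‖ₑ ^ p ∂μ with hN
  rcases eq_or_ne N ∞ with hNt | hNt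
  · rw [hNt, ENNReal.top_rpow_of_pos (by positivity), ENNReal.mul_top hD]
    exact le_top
  rcases eq_or_ne N 0 with hN0 | hN0
  · have hf0 : ∀ᵐ y ∂μ, ‖f y‖ₑ = 0 := by
      rw [hN, lintegral_eq_zero_iff (by fun_prop)] at hN0
      filter_upwards [hN0] with y hy
      simpa [hp, hp.le, hp.ne'] using hy
    have hz : ∀ x, ∫⁻ y, ‖f y‖ₑ * K x y ∂μ = 0 := fun x => by
      rw [← lintegral_zero (μ := μ)]
      refine lintegral_congr_ae ?_
      filter_upwards [hf0] with y hy
      rw [hy, zero_mul]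
    simp [hz, hq]
  set c := N.toReal with hc
  have hc0 : 0 < c := ENNReal.toReal_pos hN0 hNt
  have hNc : N = ENNReal.ofReal c := (ENNReal.ofReal_toReal hNt).symm
  have hpow : ∀ y, ENNReal.ofReal (|f y| ^ p) = ‖f y‖ₑ ^ p := fun y => by
    rw [← ENNReal.ofReal_rpow_of_nonneg (abs_nonneg _) hp.le, ← Real.norm_eq_abs, ofReal_norm]
  have hFm : Measurable fun y => |f y| ^ p / c := by fun_prop
  have hF1 : ∫⁻ y, ENNReal.ofReal (|f y| ^ p / c) ∂μ ≤ 1 := by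
    simp only [div_eq_mul_inv, ENNReal.ofReal_mul (Real.rpow_nonneg (abs_nonneg _) p), hpow]
    rw [lintegral_mul_const _ (by fun_prop), ← hN, hNc, ← ENNReal.ofReal_mul hc0.le,
      mul_inv_cancel₀ hc0.ne', ENNReal.ofReal_one]
  have hroot : ∀ y, ENNReal.ofReal ((|f y| ^ p / c) ^ (1 / p))
      = ENNReal.ofReal (c ^ (-(1 / p))) * ‖f y‖ₑ := fun y => by
    rw [Real.div_rpow (by positivity) hc0.le, ← Real.rpow_mul (abs_nonneg _),
      mul_one_div_cancel hp.ne', Real.rpow_one, div_eq_inv_mul, ← Real.rpow_neg hc0.le,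
      ENNReal.ofReal_mul (by positivity), ← Real.norm_eq_abs, ofReal_norm]
  have hnorm := lintegral_rpow_le_of_forall_lintegral_mul_le μ hq (D := D)
    (u := fun x => ENNReal.ofReal (c ^ (-(1 / p))) * ∫⁻ y, ‖f y‖ₑ * K x y ∂μ)
    (fun H hH hH0 hH1 => by
      refine le_trans (le_of_eq (lintegral_congr fun x => ?_))
        (h _ H hFm (fun y => by positivity) hH hH0 hF1 hH1)
      rw [← lintegral_const_mul _ (by fun_prop), ← lintegral_const_mul _ (by fun_prop)]
      refine lintegral_congr fun y => ?_
      rw [hroot]; ring)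
  rw [← ENNReal.rpow_inv_le_iff hq, ← one_div] at hnorm
  simp only [ENNReal.mul_rpow_of_nonneg _ _ hq.le] at hnorm
  rw [lintegral_const_mul' _ _ (by simp [hq.le]), ENNReal.mul_rpow_of_nonneg _ _ (by positivity),
    ← ENNReal.rpow_mul, mul_one_div_cancel hq.ne', ENNReal.rpow_one] at hnorm
  have hcinv : ENNReal.ofReal (c ^ (1 / p)) * ENNReal.ofReal (c ^ (-(1 / p))) = 1 := by
    rw [← ENNReal.ofReal_mul (by positivity), ← Real.rpow_add hc0]; simp
  rw [hNc, ENNReal.ofReal_rpow_of_pos hc0]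
  calc _ = ENNReal.ofReal (c ^ (1 / p)) * (ENNReal.ofReal (c ^ (-(1 / p)))
        * (∫⁻ x, (∫⁻ y, ‖f y‖ₑ * K x y ∂μ) ^ q ∂μ) ^ (1 / q)) := by
        rw [← mul_assoc, hcinv, one_mul]
    _ ≤ _ := by rw [mul_comm D]; gcongr

lemma exists_eLpNorm_rieszKernel_le {E : Type*} [NormedAddCommGroup E] [NormedSpace ℝ E]
    [FiniteDimensional ℝ E] [MeasurableSpace E] [BorelSpace E] (μ : Measure E) [μ.IsAddHaarMeasure]
    (hd : 1 ≤ Module.finrank ℝ E) {α β lam κ : ℝ} (hα : 0 ≤ α) (hβ : 0 ≤ β) (hlam : 0 < lam)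
    (h1 : α + lam < Module.finrank ℝ E) (h2 : α + β + lam < Module.finrank ℝ E)
    (hκ : κ = (α + β + lam) / Module.finrank ℝ E) :
    ∃ C : ℝ≥0∞, C ≠ ∞ ∧ ∀ p q : ℝ, 0 < p → 1 < q → 1 / q = 1 / p + κ - 1 →
      ∀ ε ε' : ℝ, 0 < ε → 0 < ε' → 1 / p = 1 - α / Module.finrank ℝ E - ε →
      1 / p = 1 - (α + lam) / Module.finrank ℝ E + ε' →
      ∀ f : E → ℝ, Measurable f →
      (∫⁻ x, (∫⁻ y, ‖f y‖ₑ * rieszKernel α β lam x y ∂μ) ^ q ∂μ) ^ (1 / q)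
        ≤ C * (ENNReal.ofReal ((κ / ε) ^ κ) + ENNReal.ofReal ((κ / ε') ^ κ))
          * (∫⁻ y, ‖f y‖ₑ ^ p ∂μ) ^ (1 / p) := by
  obtain ⟨c, hc, hK⟩ := exists_lintegral_rieszKernel_le_and_le μ hd hα hβ hlam h1 (by linarith)
  have hn : (0 : ℝ) < Module.finrank ℝ E := by exact_mod_cast hd
  set n : ℝ := (Module.finrank ℝ E : ℝ)
  refine ⟨c + 1, by simp [hc], fun p q hp hq hpq ε ε' hε hε' hpε hpε' f hf => ?_⟩
  have hκ0 : 0 < κ := by rw [hκ]; positivity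
  have hκ1 : κ < 1 := by rw [hκ, div_lt_one hn]; exact h2
  have hκs : κ = α / n + β / n + lam / n := by rw [hκ]; ring
  have hαn : 0 ≤ α / n := by positivity
  have hβn : 0 ≤ β / n := by positivity
  have hln : 0 < lam / n := by positivity
  have hαl : (α + lam) / n = α / n + lam / n := add_div _ _ _
  have hβl : (β + lam) / n = β / n + lam / n := add_div _ _ _
  have hp' : 0 < 1 / p := by positivity
  have hq' : 0 < 1 - 1 / q := by
    rw [sub_pos, div_lt_one (by linarith)]; exact hq
  refine lintegral_kernel_rpow_le μ (measurable_rieszKernel α β lam) ?_ hp (by linarith)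
    (fun F H hF hF0 hH hH0 hF1 hH1 => ?_) hf
  · refine mul_ne_zero (by simp) ?_
    have : 0 < ENNReal.ofReal ((κ / ε) ^ κ) := ENNReal.ofReal_pos.2 (by positivity)
    exact (this.trans_le le_self_add).ne'
  · refine lintegral_bilinear_le μ (measurable_rieszKernel α β lam) (c := c + 1)
      (A := 1 - α / n) (B := 1 - (β + lam) / n) (A' := 1 - (α + lam) / n) (B' := 1 - β / n)
      (κ := κ) (ε := ε) (ε' := ε') (fun s t => ?_)
      (by linarith) (by linarith) (by linarith) (by linarith) hκ0 hκ1.le (by linarith)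
      (by linarith) hε hε' (by linarith) (by linarith) (by linarith) (by linarith) hp' hq'
      hF hF0 hH hH0 hF1 hH1
    obtain ⟨hs, ht⟩ := hK s t
    exact ⟨hs.trans (by gcongr; exact le_self_add), ht.trans (by gcongr; exact le_self_add)⟩

lemma enorm_norm_rpow_mul_integral_le {E : Type*} [NormedAddCommGroup E] [MeasurableSpace E]
    {μ : Measure E} (α β lam : ℝ) (f : E → ℝ) (x : E) :
    ‖‖x‖ ^ (-β) * ∫ y, f y * ‖y‖ ^ (-α) * ‖x - y‖ ^ (-lam) ∂μ‖ₑ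
      ≤ ∫⁻ y, ‖f y‖ₑ * rieszKernel α β lam x y ∂μ := by
  rw [enorm_mul]
  refine (mul_le_mul_right (enorm_integral_le_lintegral_enorm _) _).trans (le_of_eq ?_)
  rw [← lintegral_const_mul' _ _ enorm_ne_top]
  refine lintegral_congr fun y => ?_
  rw [enorm_mul, enorm_mul, Real.enorm_of_nonneg (Real.rpow_nonneg (norm_nonneg x) (-β)),
    Real.enorm_of_nonneg (Real.rpow_nonneg (norm_nonneg y) (-α)),
    Real.enorm_of_nonneg (Real.rpow_nonneg (norm_nonneg (x - y)) (-lam)), rieszKernel]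
  ring

/-- If `f` is not a.e. strongly measurable then the integrand is not either, so the Bochner
integral vanishes. -/
lemma integral_riesz_eq_zero_of_not_aestronglyMeasurable {E : Type*} [NormedAddCommGroup E]
    [MeasurableSpace E] [BorelSpace E] {μ : Measure E} [NullSingletonClass μ] {α lam : ℝ}
    {f : E → ℝ} (hf : ¬ AEStronglyMeasurable f μ) (x : E) :
    ∫ y, f y * ‖y‖ ^ (-α) * ‖x - y‖ ^ (-lam) ∂μ = 0 := by
  refine integral_non_aestronglyMeasurable fun h => hf ?_
  have hw : Measurable fun y : E => (‖y‖ ^ (-α))⁻¹ * (‖x - y‖ ^ (-lam))⁻¹ := by fun_prop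
  refine (h.mul hw.aestronglyMeasurable).congr ?_
  filter_upwards [(Set.countable_singleton (0 : E)).ae_notMem μ,
    (Set.countable_singleton x).ae_notMem μ] with y hy0 hyx
  have h1 : ‖y‖ ^ (-α) ≠ 0 := (Real.rpow_pos_of_pos (norm_pos_iff.2 hy0) _).ne'
  have h2 : ‖x - y‖ ^ (-lam) ≠ 0 :=
    (Real.rpow_pos_of_pos (norm_pos_iff.2 (sub_ne_zero.2 (Ne.symm hyx))) _).ne'
  simp only [Pi.mul_apply]
  field_simp

section WeightedRieszOperator

variable {E : Type*} [NormedAddCommGroup E] [NormedSpace ℝ E] [FiniteDimensional ℝ E]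
  [MeasurableSpace E] [BorelSpace E] {μ : Measure E} [μ.IsAddHaarMeasure]

lemma integral_riesz_indicator_ball_pos (hd : 1 ≤ Module.finrank ℝ E) {α lam : ℝ} (hα : 0 ≤ α)
    (hlam : 0 < lam) (h1 : α + lam < Module.finrank ℝ E) (x : E) :
    0 < ∫ y, (Metric.ball (0 : E) 1).indicator (fun _ => (1 : ℝ)) y * ‖y‖ ^ (-α)
      * ‖x - y‖ ^ (-lam) ∂μ := by
  have : Nontrivial E := Module.nontrivial_of_finrank_pos (R := ℝ) hd
  obtain ⟨c, hc, hs⟩ := exists_setLIntegral_norm_rpow_mul_norm_sub_rpow_le μ hd hα hlam h1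
  have hB : MeasurableSet (Metric.ball (0 : E) 1) := Metric.isOpen_ball.measurableSet
  have heq : (fun y => (Metric.ball (0 : E) 1).indicator (fun _ => (1 : ℝ)) y * ‖y‖ ^ (-α)
      * ‖x - y‖ ^ (-lam))
      = (Metric.ball (0 : E) 1).indicator (fun y => ‖y‖ ^ (-α) * ‖x - y‖ ^ (-lam)) := by
    ext y
    by_cases hy : y ∈ Metric.ball (0 : E) 1 <;> simp [hy]
  rw [heq, integral_indicator hB]
  have hm : Measurable fun y : E => ‖y‖ ^ (-α) * ‖x - y‖ ^ (-lam) := by fun_prop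
  have hint : IntegrableOn (fun y : E => ‖y‖ ^ (-α) * ‖x - y‖ ^ (-lam)) (Metric.ball 0 1) μ := by
    refine ⟨hm.aestronglyMeasurable, ?_⟩
    refine lt_of_le_of_lt ?_ (lt_of_le_of_lt (hs (Metric.ball 0 1) x) ?_)
    · refine lintegral_mono fun y => le_of_eq ?_
      rw [enorm_mul, Real.enorm_of_nonneg (by positivity), Real.enorm_of_nonneg (by positivity),
        norm_sub_rev]
    · refine ENNReal.mul_lt_top hc.lt_top (ENNReal.rpow_lt_top_of_nonneg ?_ measure_ball_lt_top.ne)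
      have hn : (0 : ℝ) < Module.finrank ℝ E := by exact_mod_cast hd
      rw [sub_nonneg, div_le_one hn]; exact h1.le
  rw [setIntegral_pos_iff_support_of_nonneg_ae
    (Eventually.of_forall fun y => by simp only [Pi.zero_apply]; positivity) hint]
  have hsub : Metric.ball (0 : E) 1 \ {0, x}
      ⊆ Function.support (fun y : E => ‖y‖ ^ (-α) * ‖x - y‖ ^ (-lam)) ∩ Metric.ball 0 1 := by
    rintro y ⟨hy, hy'⟩
    simp only [mem_insert_iff, mem_singleton_iff, not_or] at hy'
    refine ⟨mul_ne_zero (Real.rpow_pos_of_pos (norm_pos_iff.2 hy'.1) _).ne'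
      (Real.rpow_pos_of_pos (norm_pos_iff.2 (sub_ne_zero.2 (Ne.symm hy'.2))) _).ne', hy⟩
  refine lt_of_lt_of_le ?_ (measure_mono hsub)
  rw [measure_sdiff_null ((Set.toFinite {0, x}).measure_zero μ)]
  exact Metric.measure_ball_pos μ 0 one_pos

lemma eLpNorm_riesz_indicator_ball_ne_zero (hd : 1 ≤ Module.finrank ℝ E) {α β lam : ℝ}
    (hα : 0 ≤ α) (hlam : 0 < lam) (h1 : α + lam < Module.finrank ℝ E) {q : ℝ≥0∞} (hq : q ≠ 0) :
    eLpNorm (fun x : E => ‖x‖ ^ (-β) * ∫ y, (Metric.ball (0 : E) 1).indicator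
      (fun _ => (1 : ℝ)) y * ‖y‖ ^ (-α) * ‖x - y‖ ^ (-lam) ∂μ) q μ ≠ 0 := by
  have : Nontrivial E := Module.nontrivial_of_finrank_pos (R := ℝ) hd
  have hB : MeasurableSet (Metric.ball (0 : E) 1) := Metric.isOpen_ball.measurableSet
  have hm : Measurable fun z : E × E => (Metric.ball (0 : E) 1).indicator
      (fun _ => (1 : ℝ)) z.2 * ‖z.2‖ ^ (-α) * ‖z.1 - z.2‖ ^ (-lam) := by
    have : Measurable fun z : E × E => (Metric.ball (0 : E) 1).indicator (fun _ => (1 : ℝ)) z.2 :=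
      (measurable_const.indicator hB).comp measurable_snd
    fun_prop
  have hmI : StronglyMeasurable fun x : E => ∫ y, (Metric.ball (0 : E) 1).indicator
      (fun _ => (1 : ℝ)) y * ‖y‖ ^ (-α) * ‖x - y‖ ^ (-lam) ∂μ :=
    hm.stronglyMeasurable.integral_prod_right'
  have hmβ : Measurable fun x : E => ‖x‖ ^ (-β) := by fun_prop
  intro h0
  replace h0 := (eLpNorm_eq_zero_iff (hmβ.mul hmI.measurable).aestronglyMeasurable hq).1 h0
  have hfalse : ∀ᵐ _ : E ∂μ, False := by
    filter_upwards [h0, (Set.countable_singleton (0 : E)).ae_notMem μ] with x hx hx0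
    refine mul_ne_zero (Real.rpow_pos_of_pos (norm_pos_iff.2 hx0) _).ne'
      (integral_riesz_indicator_ball_pos (μ := μ) hd hα hlam h1 x).ne' hx
  rw [eventually_false_iff_eq_bot, ae_eq_bot] at hfalse
  exact NeZero.ne μ hfalse

end WeightedRieszOperator

lemma rpow_div_add_rpow_div_le {pm pp p κ : ℝ} (hpm : 0 < pm) (hp : p ∈ Ioo pm pp) (hκ : 0 < κ) :
    (κ / (1 / pm - 1 / p)) ^ κ + (κ / (1 / p - 1 / pp)) ^ κ
      ≤ 2 * (κ * pp ^ 3) ^ κ * ((p - pm) * (pp - p)) ^ (-κ) := by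
  obtain ⟨h1, h2⟩ := hp
  have hp0 : 0 < p := hpm.trans h1
  have hpp : 0 < pp := hp0.trans h2
  have ha : 0 < p - pm := sub_pos.2 h1
  have hb : 0 < pp - p := sub_pos.2 h2
  have hX : 0 < (p - pm) * (pp - p) := mul_pos ha hb
  have e1 : κ / (1 / pm - 1 / p) = κ * (pm * p * (pp - p)) / ((p - pm) * (pp - p)) := by
    rw [div_sub_div _ _ hpm.ne' hp0.ne', one_mul, mul_one]; field_simp
  have e2 : κ / (1 / p - 1 / pp) = κ * (p * pp * (p - pm)) / ((p - pm) * (pp - p)) := by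
    rw [div_sub_div _ _ hp0.ne' hpp.ne', one_mul, mul_one]; field_simp
  have b1 : pm * p * (pp - p) ≤ pp ^ 3 := by
    have : pm * p * (pp - p) ≤ pp * pp * pp := by gcongr <;> linarith
    linarith [this, (by ring : pp * pp * pp = pp ^ 3)]
  have b2 : p * pp * (p - pm) ≤ pp ^ 3 := by
    have : p * pp * (p - pm) ≤ pp * pp * pp := by gcongr; linarith
    linarith [this, (by ring : pp * pp * pp = pp ^ 3)]
  have hfin : (κ * pp ^ 3) ^ κ * ((p - pm) * (pp - p)) ^ (-κ)
      = (κ * pp ^ 3 / ((p - pm) * (pp - p))) ^ κ := by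
    rw [Real.div_rpow (by positivity) hX.le, Real.rpow_neg hX.le, div_eq_mul_inv]
  have i1 : (κ / (1 / pm - 1 / p)) ^ κ ≤ (κ * pp ^ 3 / ((p - pm) * (pp - p))) ^ κ := by
    rw [e1]; gcongr
  have i2 : (κ / (1 / p - 1 / pp)) ^ κ ≤ (κ * pp ^ 3 / ((p - pm) * (pp - p))) ^ κ := by
    rw [e2]; gcongr
  rw [mul_assoc, hfin, two_mul]
  exact add_le_add i1 i2

lemma exists_eLpNorm_riesz_le {d : ℕ} (hd : 1 ≤ d) {α β lam : ℝ}
    (hα : 0 ≤ α) (hβ : 0 ≤ β) (hlam : 0 < lam) (h1 : α + lam < d) (h2 : α + β + lam < d)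
    {pm pp κ : ℝ} (hpm : pm = d / (d - α)) (hpp : pp = d / (d - α - lam))
    (hκ : κ = (α + β + lam) / d) :
    ∃ C : ℝ≥0∞, C ≠ ∞ ∧ ∀ p ∈ Ioo pm pp, ∀ f : EuclideanSpace ℝ (Fin d) → ℝ,
      eLpNorm (fun x : EuclideanSpace ℝ (Fin d) => ‖x‖ ^ (-β) *
          ∫ y : EuclideanSpace ℝ (Fin d), f y * ‖y‖ ^ (-α) * ‖x - y‖ ^ (-lam))
        (ENNReal.ofReal (1 / p + κ - 1)⁻¹) volume
      ≤ C * ENNReal.ofReal (((p - pm) * (pp - p)) ^ (-κ))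
        * eLpNorm f (ENNReal.ofReal p) volume := by
  have hfr : Module.finrank ℝ (EuclideanSpace ℝ (Fin d)) = d := finrank_euclideanSpace_fin
  have hd0 : (0 : ℝ) < d := by exact_mod_cast hd
  have : Nontrivial (EuclideanSpace ℝ (Fin d)) :=
    Module.nontrivial_of_finrank_pos (R := ℝ) (by rw [hfr]; exact hd)
  obtain ⟨C, hC, hbound⟩ := exists_eLpNorm_rieszKernel_le
    (volume : Measure (EuclideanSpace ℝ (Fin d))) (by rwa [hfr]) hα hβ hlam
    (by rwa [hfr]) (by rwa [hfr]) (κ := κ) (by rwa [hfr])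
  simp only [hfr] at hbound
  have hpm' : 1 / pm = 1 - α / d := by
    rw [hpm, one_div_div, sub_div, div_self hd0.ne']
  have hpp' : 1 / pp = 1 - (α + lam) / d := by
    rw [hpp, one_div_div, sub_sub, sub_div, div_self hd0.ne']
  have hpm0 : 0 < pm := by rw [hpm]; apply div_pos hd0; linarith
  have hκ0 : 0 < κ := by rw [hκ]; positivity
  have hκs : κ = (α + lam) / d + β / d := by rw [hκ]; ring
  have hκs' : κ = α / d + (β + lam) / d := by rw [hκ]; ring
  have hβd : 0 ≤ β / d := by positivity
  have hβl : (β + lam) / d < 1 := by rw [div_lt_one hd0]; linarith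
  refine ⟨C * ENNReal.ofReal (2 * (κ * pp ^ 3) ^ κ), ENNReal.mul_ne_top hC ENNReal.ofReal_ne_top,
    fun p hp f => ?_⟩
  have hp0 : 0 < p := hpm0.trans hp.1
  have hlt1 : 1 / p < 1 / pm := one_div_lt_one_div_of_lt hpm0 hp.1
  have hlt2 : 1 / pp < 1 / p := one_div_lt_one_div_of_lt hp0 hp.2
  have hinv0 : 0 < 1 / p + κ - 1 := by linarith
  have hinv1 : 1 / p + κ - 1 < 1 := by linarith
  set q := (1 / p + κ - 1)⁻¹ with hq
  have hq1 : 1 < q := (one_lt_inv₀ hinv0).2 hinv1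
  have hq0 : 0 < q := one_pos.trans hq1
  by_cases hf : AEStronglyMeasurable f volume
  swap
  · simp only [integral_riesz_eq_zero_of_not_aestronglyMeasurable hf, mul_zero, eLpNorm_zero']
    exact zero_le
  set g := hf.mk f with hg_def
  have hfg : f =ᵐ[volume] g := hf.ae_eq_mk
  have hg : Measurable g := hf.stronglyMeasurable_mk.measurable
  have hIfg : ∀ x : EuclideanSpace ℝ (Fin d),
      ∫ y : EuclideanSpace ℝ (Fin d), f y * ‖y‖ ^ (-α) * ‖x - y‖ ^ (-lam)
        = ∫ y : EuclideanSpace ℝ (Fin d), g y * ‖y‖ ^ (-α) * ‖x - y‖ ^ (-lam) := fun x => by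
    refine integral_congr_ae ?_
    filter_upwards [hfg] with y hy
    rw [hy]
  simp only [hIfg]
  rw [eLpNorm_congr_ae hfg, eLpNorm_eq_lintegral_rpow_enorm_toReal (by simpa using hq0) (by simp),
    eLpNorm_eq_lintegral_rpow_enorm_toReal (by simpa using hp0) (by simp),
    ENNReal.toReal_ofReal hq0.le, ENNReal.toReal_ofReal hp0.le]
  calc _ ≤ (∫⁻ x : EuclideanSpace ℝ (Fin d),
        (∫⁻ y, ‖g y‖ₑ * rieszKernel α β lam x y) ^ q) ^ (1 / q) := by
        gcongr with x
        exact enorm_norm_rpow_mul_integral_le α β lam g x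
    _ ≤ _ := hbound p q hp0 hq1 (by rw [hq, one_div, inv_inv]) (1 / pm - 1 / p) (1 / p - 1 / pp)
        (by linarith) (by linarith) (by linarith) (by linarith) g hg
    _ ≤ _ := by
        rw [mul_assoc C (ENNReal.ofReal (2 * _)), ← ENNReal.ofReal_mul (by
          have : 0 < pp := hp0.trans hp.2
          positivity)]
        have hx1 : 0 < 1 / pm - 1 / p := by linarith
        have hx2 : 0 < 1 / p - 1 / pp := by linarith
        rw [← ENNReal.ofReal_add (by positivity) (by positivity)]
        exact mul_le_mul_left (mul_le_mul_right (ENNReal.ofReal_le_ofReal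
          (rpow_div_add_rpow_div_le hpm0 hp hκ0)) _) _

lemma BGLS_indicator_ball_ne_top {d : ℕ} {I : Set ℝ} (hI : ∀ p ∈ I, 1 ≤ p) :
    BGLS d I (fun _ => 1) ((Metric.ball (0 : EuclideanSpace ℝ (Fin d)) 1).indicator
      fun _ => (1 : ℝ)) ≠ ∞ := by
  have hball : volume (Metric.ball (0 : EuclideanSpace ℝ (Fin d)) 1) ≠ ∞ := measure_ball_lt_top.ne
  refine ne_top_of_le_ne_top (b := volume (Metric.ball (0 : EuclideanSpace ℝ (Fin d)) 1) + 1)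
    (by simp [hball]) (iSup₂_le fun p hp => ?_)
  have hp1 := hI p hp
  have hp0 : 0 < p := by linarith
  rw [eLpNorm_indicator_const Metric.isOpen_ball.measurableSet (by simpa using hp0) (by simp),
    ENNReal.toReal_ofReal hp0.le, ENNReal.ofReal_one, div_one, enorm_one, one_mul]
  set m := volume (Metric.ball (0 : EuclideanSpace ℝ (Fin d)) 1)
  rcases le_total m 1 with hm | hm
  · exact (ENNReal.rpow_le_one hm (by positivity)).trans le_add_self
  · refine (ENNReal.rpow_le_rpow_of_exponent_le hm ((div_le_one hp0).2 hp1)).trans ?_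
    rw [ENNReal.rpow_one]; exact le_self_add

/-- Theorem 6: two-sided estimate for the best BGLS constant of the weighted
Riesz-type operator `I_{α,β,λ}[f](x) = |x|^{-β} ∫ f(y) |y|^{-α} |x-y|^{-λ} dy`. -/
theorem weighted_riesz_bgls_constant_two_sided
    (d : ℕ) (hd : 1 ≤ d) (α β lam : ℝ)
    (hα : 0 ≤ α) (hβ : 0 ≤ β) (hlam : 0 < lam)
    (h1 : α + lam < d) (h2 : α + β + lam < d)
    (I : (EuclideanSpace ℝ (Fin d) → ℝ) → EuclideanSpace ℝ (Fin d) → ℝ)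
    (hI : ∀ f x, I f x = ‖x‖ ^ (-β) *
      ∫ y : EuclideanSpace ℝ (Fin d), f y * ‖y‖ ^ (-α) * ‖x - y‖ ^ (-lam))
    -- `p₋ , p₊ , κ` and `q = q(p)` given by `1 + 1/q = 1/p + (α+β+λ)/d`
    (pm pp κ : ℝ) (q : ℝ → ℝ)
    (hpm : pm = d / (d - α)) (hpp : pp = d / (d - α - lam))
    (hκ : κ = (α + β + lam) / d)
    (hq : ∀ p, q p = (1/p + κ - 1)⁻¹)
    -- `V`: the smallest admissible constant
    (V : ℝ≥0∞)
    (hV : V = sInf {W : ℝ≥0∞ |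
      ∀ ψ : ℝ → ℝ, PsiClass (Set.Ioo pm pp) ψ → ∀ f : EuclideanSpace ℝ (Fin d) → ℝ,
        (⨆ p ∈ Set.Ioo pm pp,
            eLpNorm (I f) (ENNReal.ofReal (q p)) volume /
              ENNReal.ofReal (((p - pm) * (pp - p)) ^ (-κ) * ψ p))
          ≤ W * BGLS d (Set.Ioo pm pp) ψ f}) :
    ∃ C1 C2 : ℝ≥0∞, 0 < C1 ∧ C1 ≤ C2 ∧ C2 < ⊤ ∧ C1 ≤ V ∧ V ≤ C2 := by
  have hd0 : (0 : ℝ) < d := by exact_mod_cast hd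
  have hfr : Module.finrank ℝ (EuclideanSpace ℝ (Fin d)) = d := finrank_euclideanSpace_fin
  have hpm1 : 1 ≤ pm := by
    rw [hpm, le_div_iff₀ (by linarith)]; linarith
  have hpmpp : pm < pp := by
    rw [hpm, hpp]
    exact div_lt_div_of_pos_left hd0 (by linarith) (by linarith)
  have hIeq : ∀ f, I f = fun x => ‖x‖ ^ (-β) *
      ∫ y : EuclideanSpace ℝ (Fin d), f y * ‖y‖ ^ (-α) * ‖x - y‖ ^ (-lam) :=
    fun f => funext (hI f)
  have hVtop : V < ∞ := by
    obtain ⟨C, hC, hbound⟩ := exists_eLpNorm_riesz_le hd hα hβ hlam h1 h2 hpm hpp hκ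
    rw [hV]
    refine lt_of_le_of_lt (sInf_le ?_) hC.lt_top
    intro ψ hψ f
    refine iSup₂_le fun p hp => ?_
    have hX : 0 < ((p - pm) * (pp - p)) ^ (-κ) :=
      Real.rpow_pos_of_pos (mul_pos (sub_pos.2 hp.1) (sub_pos.2 hp.2)) _
    have hψp : 0 < ψ p := hψ.2.1 p hp
    have hle : eLpNorm f (ENNReal.ofReal p) volume / ENNReal.ofReal (ψ p)
        ≤ BGLS d (Set.Ioo pm pp) ψ f :=
      le_iSup₂ (f := fun p _ => eLpNorm f (ENNReal.ofReal p) volume / ENNReal.ofReal (ψ p)) p hp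
    refine le_trans ?_ (mul_le_mul_right hle C)
    have hb := hbound p hp f
    rw [← hq p, ← hIeq f] at hb
    refine ENNReal.div_le_of_le_mul (hb.trans (le_of_eq ?_))
    have hψ0 : ENNReal.ofReal (ψ p) ≠ 0 := (ENNReal.ofReal_pos.2 hψp).ne'
    rw [ENNReal.ofReal_mul hX.le]
    calc _ = C * ENNReal.ofReal (((p - pm) * (pp - p)) ^ (-κ))
          * (eLpNorm f (ENNReal.ofReal p) volume / ENNReal.ofReal (ψ p)
            * ENNReal.ofReal (ψ p)) := by
          rw [ENNReal.div_mul_cancel hψ0 ENNReal.ofReal_ne_top]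
      _ = _ := by ring
  have hVpos : 0 < V := by
    obtain ⟨p, hp⟩ := exists_between hpmpp
    have hp : p ∈ Set.Ioo pm pp := hp
    set f : EuclideanSpace ℝ (Fin d) → ℝ :=
      (Metric.ball (0 : EuclideanSpace ℝ (Fin d)) 1).indicator fun _ => (1 : ℝ) with hf
    have hψ : PsiClass (Set.Ioo pm pp) (fun _ => 1) :=
      ⟨continuousOn_const, fun _ _ => one_pos, 1, one_pos, fun _ _ => le_rfl⟩
    have hN : BGLS d (Set.Ioo pm pp) (fun _ => 1) f ≠ ∞ :=
      BGLS_indicator_ball_ne_top fun p hp => hpm1.trans hp.1.le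
    have hqp : 0 < q p := by
      have hpp' : 1 / pp = 1 - (α + lam) / d := by
        rw [hpp, one_div_div, sub_sub, sub_div, div_self hd0.ne']
      have hlt : 1 / pp < 1 / p := one_div_lt_one_div_of_lt (by linarith [hp.1]) hp.2
      have hκs : κ = (α + lam) / d + β / d := by rw [hκ]; ring
      have hβd : 0 ≤ β / d := by positivity
      rw [hq]
      exact inv_pos.2 (by linarith)
    have hne : eLpNorm (I f) (ENNReal.ofReal (q p)) volume ≠ 0 := by
      rw [hIeq f]
      exact eLpNorm_riesz_indicator_ball_ne_zero (by rwa [hfr]) hα hlam (by rwa [hfr])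
        (by simpa using hqp)
    refine lt_of_lt_of_le (b := eLpNorm (I f) (ENNReal.ofReal (q p)) volume /
        ENNReal.ofReal (((p - pm) * (pp - p)) ^ (-κ) * 1) / BGLS d (Set.Ioo pm pp) (fun _ => 1) f)
      (ENNReal.div_pos (ENNReal.div_pos hne ENNReal.ofReal_ne_top).ne' hN) ?_
    rw [hV]
    refine le_sInf fun W hW => ENNReal.div_le_of_le_mul (le_trans ?_ (hW _ hψ f))
    exact le_iSup₂ (f := fun p (_ : p ∈ Set.Ioo pm pp) =>
      eLpNorm (I f) (ENNReal.ofReal (q p)) volume /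
        ENNReal.ofReal (((p - pm) * (pp - p)) ^ (-κ) * 1)) p hp
  exact ⟨V, V, hVpos, le_rfl, hVtop, le_rfl, le_rfl⟩
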